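/- Let n, θ > 0, ε ∈ (0,1), β ∈ ℝ, and α ∈ ℝ with α < −1. Define κ = β²/2 + β and, for ρ > 0, 𝒥(ρ) = e^{1/ρ}·ρ^α·[(κ+1)·Γ(α+1, 1/ρ) − ((κ − β/2)/ρ²)·Γ(α−1, 1/ρ)], where Γ(a,x) = ∫_x^∞ t^{a−1} e^{−t} dt is the upper incomplete gamma function. Then lim_{ρ→∞} −ln(ε + (1−ε)·𝒥(ρ))/(nθ) = −ln(ε)/(nθ). -/

import Mathlib

open MeasureTheory Set Real Filter

/-- The upper incomplete gamma function `Γ(a,x) = ∫_x^∞ t^{a−1} e^{−t} dt`. -/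
noncomputable def upperGamma (a x : ℝ) : ℝ :=
  ∫ t in Set.Ioi x, t ^ (a - 1) * Real.exp (-t)

theorem upperGamma_nonneg (a : ℝ) {x : ℝ} (hx : 0 < x) : 0 ≤ upperGamma a x :=
  setIntegral_nonneg measurableSet_Ioi fun _ ht =>
    mul_nonneg (Real.rpow_nonneg (hx.trans ht).le _) (Real.exp_pos _).le

theorem upperGamma_le_of_neg {a x : ℝ} (ha : a < 0) (hx : 0 < x) :
    upperGamma a x ≤ x ^ a / (-a) := by
  have hint : IntegrableOn (fun t : ℝ => t ^ (a - 1)) (Set.Ioi x) :=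
    integrableOn_Ioi_rpow_of_lt (by linarith) hx
  have hle : ∀ t ∈ Set.Ioi x, t ^ (a - 1) * Real.exp (-t) ≤ t ^ (a - 1) := fun t ht =>
    mul_le_of_le_one_right (Real.rpow_nonneg (hx.trans ht).le _)
      (Real.exp_le_one_iff.2 (neg_nonpos.2 (hx.trans ht).le))
  calc upperGamma a x ≤ ∫ t in Set.Ioi x, t ^ (a - 1) :=
        integral_mono_of_nonneg
          (ae_restrict_of_forall_mem measurableSet_Ioi fun t ht =>
            mul_nonneg (Real.rpow_nonneg (hx.trans ht).le _) (Real.exp_pos _).le)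
          hint (ae_restrict_of_forall_mem measurableSet_Ioi hle)
    _ = x ^ a / (-a) := by
        rw [integral_Ioi_rpow_of_lt (by linarith) hx, sub_add_cancel, div_neg, neg_div]

theorem tendsto_rpow_mul_upperGamma_one_div {a b : ℝ} (ha : a < 0) (hb : b < a) :
    Tendsto (fun ρ : ℝ => ρ ^ b * upperGamma a (1 / ρ)) atTop (nhds 0) := by
  have hlim : Tendsto (fun ρ : ℝ => ρ ^ (-(a - b)) / (-a)) atTop (nhds 0) := by
    simpa using (tendsto_rpow_neg_atTop (sub_pos.2 hb)).div_const (-a)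
  refine squeeze_zero' ?_ ?_ hlim
  · filter_upwards [eventually_gt_atTop 0] with ρ hρ
    exact mul_nonneg (Real.rpow_nonneg hρ.le _) (upperGamma_nonneg a (one_div_pos.2 hρ))
  · filter_upwards [eventually_gt_atTop 0] with ρ hρ
    calc ρ ^ b * upperGamma a (1 / ρ) ≤ ρ ^ b * ((1 / ρ) ^ a / (-a)) :=
          mul_le_mul_of_nonneg_left (upperGamma_le_of_neg ha (one_div_pos.2 hρ))
            (Real.rpow_nonneg hρ.le _)
      _ = ρ ^ (-(a - b)) / (-a) := by
          rw [one_div, Real.inv_rpow hρ.le, ← Real.rpow_neg hρ.le, ← mul_div_assoc,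
            ← Real.rpow_add hρ]
          ring_nf

/-- for `n, θ > 0`, `ε ∈ (0,1)`, `α < −1`, with `κ = β²/2 + β` and
`𝒥(ρ) = e^{1/ρ} ρ^α [(κ+1)Γ(α+1,1/ρ) − ((κ−β/2)/ρ²)Γ(α−1,1/ρ)]`, the effective capacity
`−ln(ε + (1−ε)𝒥(ρ))/(nθ)` tends to `−ln(ε)/(nθ)` as `ρ → ∞`. -/
theorem effective_capacity_high_SNR_limit
    (n θ ε β α : ℝ) (hn : 0 < n) (hθ : 0 < θ) (hε0 : 0 < ε) (hε1 : ε < 1)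
    (hα : α < -1) (κ : ℝ) (hκ : κ = β ^ 2 / 2 + β)
    (J : ℝ → ℝ)
    (hJ : ∀ ρ : ℝ, 0 < ρ →
      J ρ = Real.exp (1 / ρ) * ρ ^ α *
        ((κ + 1) * upperGamma (α + 1) (1 / ρ) -
          (κ - β / 2) / ρ ^ 2 * upperGamma (α - 1) (1 / ρ))) :
    Filter.Tendsto (fun ρ => -Real.log (ε + (1 - ε) * J ρ) / (n * θ))
      Filter.atTop (nhds (-Real.log ε / (n * θ))) := by
  have hexp : Tendsto (fun ρ : ℝ => Real.exp (1 / ρ)) atTop (nhds 1) := by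
    have hinv : Tendsto (fun ρ : ℝ => 1 / ρ) atTop (nhds 0) := by
      simpa using tendsto_inv_atTop_zero (𝕜 := ℝ)
    simpa [Function.comp_def] using (Real.continuous_exp.tendsto 0).comp hinv
  have hJ0 : Tendsto J atTop (nhds 0) := by
    have h₁ := (tendsto_rpow_mul_upperGamma_one_div
      (show α + 1 < 0 by linarith) (show α < α + 1 by linarith)).const_mul (κ + 1)
    have h₂ := (tendsto_rpow_mul_upperGamma_one_div
      (show α - 1 < 0 by linarith) (show α - 2 < α - 1 by linarith)).const_mul (κ - β / 2)
    have h := hexp.mul (h₁.sub h₂)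
    simp only [mul_zero, sub_zero] at h
    refine h.congr' ?_
    filter_upwards [eventually_gt_atTop 0] with ρ hρ
    rw [hJ ρ hρ, Real.rpow_sub hρ, Real.rpow_two]
    ring
  have hlog : Tendsto (fun ρ => Real.log (ε + (1 - ε) * J ρ)) atTop (nhds (Real.log ε)) := by
    have h : Tendsto (fun ρ => ε + (1 - ε) * J ρ) atTop (nhds ε) := by
      simpa using (hJ0.const_mul (1 - ε)).const_add ε
    exact h.log hε0.ne'
  exact hlog.neg.div_const _
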